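/- Let H be a real inner product space, let F : H → ℝ be convex, and let x̂ ∈ H, η > 0, δ > 0 be such that F(y) ≥ F(x̂) + δ for every y ∈ H with ‖y − x̂‖ = η. Then for every z ∈ H with ‖z − x̂‖ ≥ η and every g ∈ H satisfying the subgradient inequality F(w) ≥ F(z) + ⟨g, w − z⟩ for all w ∈ H, one has ‖g‖ ≥ δ/η. -/

import Mathlib

open RealInnerProductSpace

/-- if a convex function exceeds its value at `xhat` by at least `δ`
everywhere on the sphere of radius `η` around `xhat`, then every subgradient at any point
at distance at least `η` from `xhat` has norm at least `δ/η`. -/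
theorem convex_subgradient_lower_bound
    {H : Type*} [NormedAddCommGroup H] [InnerProductSpace ℝ H]
    (F : H → ℝ) (hF : ConvexOn ℝ Set.univ F)
    (xhat : H) (η δ : ℝ) (hη : 0 < η) (hδ : 0 < δ)
    (hsphere : ∀ y, ‖y - xhat‖ = η → F xhat + δ ≤ F y)
    (z : H) (hz : η ≤ ‖z - xhat‖) (g : H)
    (hg : ∀ w, F z + ⟪g, w - z⟫ ≤ F w) :
    δ / η ≤ ‖g‖ := by
  have hr : 0 < ‖z - xhat‖ := hη.trans_le hz
  have ht0 : 0 ≤ η / ‖z - xhat‖ := by positivity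
  have ht1 : η / ‖z - xhat‖ ≤ 1 := (div_le_one hr).2 hz
  have htr : η / ‖z - xhat‖ * ‖z - xhat‖ = η := div_mul_cancel₀ _ hr.ne'
  set t := η / ‖z - xhat‖
  have hy : ‖((1 - t) • xhat + t • z) - xhat‖ = η := by
    have : ((1 - t) • xhat + t • z) - xhat = t • (z - xhat) := by module
    rw [this, norm_smul, Real.norm_of_nonneg ht0, htr]
  have hconv := hF.2 (Set.mem_univ xhat) (Set.mem_univ z) (sub_nonneg.2 ht1) ht0
    (sub_add_cancel 1 t)
  simp only [smul_eq_mul] at hconv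
  have hgap : δ ≤ t * (F z - F xhat) := by linarith [hsphere _ hy]
  have hslope : F z - F xhat ≤ ‖g‖ * ‖z - xhat‖ := by
    have hinner := neg_le_of_abs_le (abs_real_inner_le_norm g (xhat - z))
    rw [norm_sub_rev xhat z] at hinner
    linarith [hg xhat]
  rw [div_le_iff₀ hη]
  calc δ ≤ t * (F z - F xhat) := hgap
    _ ≤ t * (‖g‖ * ‖z - xhat‖) := by gcongr
    _ = ‖g‖ * (t * ‖z - xhat‖) := by ring
    _ = ‖g‖ * η := by rw [htr]
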